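/- Let K be a commutative ring, n ≥ 4, and c_1,…,c_n ∈ K with η(c_n)·η(c_{n−1})⋯η(c_2)·η(c_1) = −Id. For 1 ≤ i ≤ j ≤ n define Q(i,j) ∈ K by Q(i,i) = 0, Q(i,i+1) = 1, and Q(i,j) = the (1,1)-entry of η(c_{j−2})·η(c_{j−3})⋯η(c_{i+1})·η(c_i) for j ≥ i+2. Then the Q(i,j) satisfy the Plücker relations: for all 1 ≤ i < j < k < l ≤ n, Q(i,k)·Q(j,l) = Q(i,j)·Q(k,l) + Q(i,l)·Q(j,k). -/

import Mathlib

/-- The matrix `η(x) = [[x, -1], [1, 0]]`. -/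
def eta {K : Type*} [CommRing K] (x : K) : Matrix (Fin 2) (Fin 2) K :=
  !![x, -1; 1, 0]

/-- `Q(i,j)` for `i ≤ j`: `Q(i,i) = 0`, `Q(i,i+1) = 1` (the empty product), and for
`j ≥ i+2` the `(1,1)`-entry of `η(c_{j-2})·η(c_{j-3})⋯η(c_{i+1})·η(c_i)`. -/
def Qf {K : Type*} [CommRing K] (c : ℕ → K) (i j : ℕ) : K :=
  if i = j then 0
  else ((((List.range (j - 1 - i)).map (fun k => eta (c (i + k)))).reverse).prod) 0 0

theorem eta_mul_apply_zero {K : Type*} [CommRing K] (x : K) (M : Matrix (Fin 2) (Fin 2) K)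
    (b : Fin 2) : (eta x * M) 0 b = x * M 0 b - M 1 b := by
  simp [eta, Matrix.mul_apply, Fin.sum_univ_two, sub_eq_add_neg]

theorem eta_mul_apply_one {K : Type*} [CommRing K] (x : K) (M : Matrix (Fin 2) (Fin 2) K)
    (b : Fin 2) : (eta x * M) 1 b = M 0 b := by
  simp [eta, Matrix.mul_apply, Fin.sum_univ_two]

theorem Qf_self {K : Type*} [CommRing K] (c : ℕ → K) (i : ℕ) : Qf c i i = 0 := by
  simp [Qf]

theorem Qf_succ {K : Type*} [CommRing K] (c : ℕ → K) (i : ℕ) : Qf c i (i + 1) = 1 := by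
  simp [Qf]

/-- The three-term recurrence satisfied by `Q(i, ·)`. -/
theorem Qf_add_two {K : Type*} [CommRing K] (c : ℕ → K) {i j : ℕ} (h : i ≤ j) :
    Qf c i (j + 2) = c j * Qf c i (j + 1) - Qf c i j := by
  obtain ⟨m, rfl⟩ := Nat.exists_eq_add_of_le h
  have step (m : ℕ) : Qf c i (i + m + 1) =
      ((((List.range m).map (fun k => eta (c (i + k)))).reverse).prod) 0 0 := by
    rw [Qf, if_neg (by omega), show i + m + 1 - 1 - i = m by omega]
  rw [show i + m + 2 = i + (m + 1) + 1 by omega, step, step]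
  cases m with
  | zero => simp [Qf, eta]
  | succ m =>
    rw [show i + (m + 1) = i + m + 1 by omega, step]
    simp only [List.range_succ, List.map_append, List.map_cons, List.map_nil,
      List.reverse_append, List.reverse_singleton, List.singleton_append, List.prod_cons,
      eta_mul_apply_zero, eta_mul_apply_one, Nat.add_assoc]

/-- The Casoratian of `Q(i, ·)` and `Q(j, ·)` is the constant `Q(i,j)`. -/
theorem Qf_mul_Qf_succ {K : Type*} [CommRing K] (c : ℕ → K) {i j k : ℕ}
    (hij : i ≤ j) (hjk : j ≤ k) :
    Qf c i k * Qf c j (k + 1) = Qf c i j + Qf c i (k + 1) * Qf c j k := by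
  induction k, hjk using Nat.le_induction with
  | base => simp [Qf_self, Qf_succ]
  | succ k hjk ih =>
    rw [Qf_add_two c hjk, Qf_add_two c (hij.trans hjk)]
    linear_combination ih

theorem Qf_plucker {K : Type*} [CommRing K] (c : ℕ → K) {i j k l : ℕ}
    (hij : i ≤ j) (hjk : j ≤ k) (hkl : k ≤ l) :
    Qf c i k * Qf c j l = Qf c i j * Qf c k l + Qf c i l * Qf c j k := by
  obtain ⟨m, rfl⟩ := Nat.exists_eq_add_of_le hkl
  clear hkl
  induction m using Nat.twoStepInduction with
  | zero => simp [Qf_self]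
  | one => simpa [Qf_succ] using Qf_mul_Qf_succ c hij hjk
  | more m ih₀ ih₁ =>
    rw [← Nat.add_assoc] at ih₁
    rw [show k + (m + 2) = k + m + 2 by omega, Qf_add_two c (by omega : j ≤ k + m),
      Qf_add_two c (by omega : i ≤ k + m), Qf_add_two c (by omega : k ≤ k + m)]
    linear_combination c (k + m) * ih₁ - ih₀

/-- If `η(c_n)·η(c_{n-1})⋯η(c_2)·η(c_1) = -Id` with `n ≥ 4`, then the `Q(i,j)`
satisfy the Plücker relations: for all `1 ≤ i < j < k < l ≤ n`,
`Q(i,k)·Q(j,l) = Q(i,j)·Q(k,l) + Q(i,l)·Q(j,k)`. -/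
theorem stmt_14 {K : Type*} [CommRing K] (n : ℕ) (hn : 4 ≤ n) (c : ℕ → K)
    (h : (((List.range n).map (fun m => eta (c (m + 1)))).reverse).prod = -1)
    (i j k l : ℕ) (h1 : 1 ≤ i) (h2 : i < j) (h3 : j < k) (h4 : k < l) (h5 : l ≤ n) :
    Qf c i k * Qf c j l = Qf c i j * Qf c k l + Qf c i l * Qf c j k :=
  Qf_plucker c h2.le h3.le h4.le
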